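/- arXiv:1603.07875 — 2 statements merged into one kernel-verified Lean document; each statement's English description precedes it below -/
import Mathlib

section
/- Given real numbers f', g', LMP, Γ, Δt, α₂ ≥ 0, α₄ ≥ 0 and efficiencies η_c, η_d with η_d ≠ 0 and 0 < η_c·η_d < 1, if the stationarity equations −f' + α₂ − η_c·Γ·Δt + LMP = 0 and g' + α₄ + Γ·Δt/η_d − LMP = 0 both hold, then LMP ≤ (f' − η_c·η_d·g')/(1 − η_c·η_d). In particular, the strict inequality LMP > (f' − η_c·η_d·g')/(1 − η_c·η_d) (Condition 1 of the paper) cannot hold at such a point. -/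
theorem lmp_upper_bound
    (f' g' LMP Γ Δt α₂ α₄ ηc ηd : ℝ)
    (hα₂ : 0 ≤ α₂) (hα₄ : 0 ≤ α₄)
    (hηd : ηd ≠ 0) (hcd0 : 0 < ηc * ηd) (hcd1 : ηc * ηd < 1)
    (h1 : -f' + α₂ - ηc * Γ * Δt + LMP = 0)
    (h2 : g' + α₄ + Γ * Δt / ηd - LMP = 0) :
    LMP ≤ (f' - ηc * ηd * g') / (1 - ηc * ηd) ∧
      ¬ (LMP > (f' - ηc * ηd * g') / (1 - ηc * ηd)) := by
  have key : LMP ≤ (f' - ηc * ηd * g') / (1 - ηc * ηd) := by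
    have hΓ : Γ * Δt = (LMP - g' - α₄) * ηd := by
      rw [← div_eq_iff hηd]
      linarith
    rw [le_div_iff₀ (sub_pos.mpr hcd1)]
    linear_combination h1 + ηc * hΓ + hα₂ + (ηc * ηd) * hα₄
  exact ⟨key, not_lt.mpr key⟩
end

section
/- Given real numbers f', g', LMP, Γ, α₂ ≥ 0, α₄ ≥ 0, Δt > 0 and efficiencies η_c, η_d with 0 < η_c ≤ 1, 0 < η_d ≤ 1 and η_c·η_d < 1, if f' < g' and the stationarity equations −f' + α₂ − η_c·Γ·Δt + LMP = 0 and g' + α₄ + Γ·Δt/η_d − LMP = 0 both hold, then Γ < 0. -/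
theorem gamma_neg
    (f' g' LMP Γ α₂ α₄ Δt ηc ηd : ℝ)
    (hα₂ : 0 ≤ α₂) (hα₄ : 0 ≤ α₄) (hΔt : 0 < Δt)
    (hηc0 : 0 < ηc) (hηc1 : ηc ≤ 1)
    (hηd0 : 0 < ηd) (hηd1 : ηd ≤ 1)
    (hcd : ηc * ηd < 1)
    (hfg : f' < g')
    (h1 : -f' + α₂ - ηc * Γ * Δt + LMP = 0)
    (h2 : g' + α₄ + Γ * Δt / ηd - LMP = 0) :
    Γ < 0 := by
  have hgap : 0 < 1 / ηd - ηc := sub_pos.mpr ((lt_div_iff₀ hηd0).mpr hcd)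
  have hsum : Γ * (Δt * (1 / ηd - ηc)) = -(g' - f' + α₂ + α₄) := by
    linear_combination h1 + h2
  exact neg_of_mul_neg_left (by linarith) (mul_pos hΔt hgap).le
end
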